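/- arXiv:2508.13254 — 3 statements merged into one kernel-verified Lean document; each statement's English description precedes it below -/
import Mathlib

section
/- Let m₁ < m₂ be positive integers and s ∈ ℂ. Then the two series Σ_{n=0}^∞ q^{(s−n−3)m₁+(n+1)m₂}/([m₁]_q^{s−n−2}[m₂]_q^{n+2}) and Σ_{n=0}^∞ q^{(−n−1)m₁+(s+n−1)m₂}[m₁]_q^{n}/[m₂]_q^{s+n} converge absolutely, and their difference equals (1−q)²/((1−q^{m₂})² − (1−q^{m₁})(1−q^{m₂})q^{m₂−m₁}) · (q^{(s−3)m₁+m₂}/[m₁]_q^{s−2} − q^{−m₁+(s−1)m₂}/[m₂]_q^{s−2}). -/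
open Complex

/-- The `q`-analogue `[n]_q = (1 - q^n)/(1 - q)` of a natural number `n`. -/
noncomputable def qnum (q : ℝ) (n : ℕ) : ℝ := (1 - q ^ n) / (1 - q)

lemma qnum_pos {q : ℝ} (hq0 : 0 < q) (hq1 : q < 1) {n : ℕ} (hn : 0 < n) : 0 < qnum q n :=
  div_pos (sub_pos.2 (pow_lt_one₀ hq0.le hq1 hn.ne')) (sub_pos.2 hq1)

lemma qnum_lt_qnum {q : ℝ} (hq0 : 0 < q) (hq1 : q < 1) {m n : ℕ} (h : m < n) :
    qnum q m < qnum q n :=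
  div_lt_div_of_pos_right (sub_lt_sub_left (pow_lt_pow_right_of_lt_one₀ hq0 hq1 h) 1)
    (sub_pos.2 hq1)

/-- The common ratio of the two geometric series. -/
noncomputable def qratio (q : ℝ) (m n : ℕ) : ℝ := q ^ (n - m) * qnum q m / qnum q n

lemma qratio_nonneg {q : ℝ} (hq0 : 0 < q) (hq1 : q < 1) {m n : ℕ} (hm : 0 < m) (h : m < n) :
    0 ≤ qratio q m n :=
  div_nonneg (mul_nonneg (pow_pos hq0 _).le (qnum_pos hq0 hq1 hm).le)
    (qnum_pos hq0 hq1 (hm.trans h)).le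

lemma qratio_lt_one {q : ℝ} (hq0 : 0 < q) (hq1 : q < 1) {m n : ℕ} (hm : 0 < m) (h : m < n) :
    qratio q m n < 1 := by
  rw [qratio, div_lt_one (qnum_pos hq0 hq1 (hm.trans h))]
  exact (mul_le_of_le_one_left (qnum_pos hq0 hq1 hm).le (pow_le_one₀ hq0.le hq1.le)).trans_lt
    (qnum_lt_qnum hq0 hq1 h)

lemma qnum_sq_mul_one_sub_qratio {q : ℝ} (hq0 : 0 < q) (hq1 : q < 1) {m n : ℕ} (hn : 0 < n) :
    qnum q n ^ 2 * (1 - qratio q m n) =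
      ((1 - q ^ n) ^ 2 - (1 - q ^ m) * (1 - q ^ n) * q ^ (n - m)) / (1 - q) ^ 2 := by
  have hb : qnum q n ≠ 0 := (qnum_pos hq0 hq1 hn).ne'
  have hq : 1 - q ≠ 0 := (sub_pos.2 hq1).ne'
  have h : qnum q n ^ 2 * (1 - qratio q m n) =
      qnum q n ^ 2 - qnum q m * qnum q n * q ^ (n - m) := by
    rw [qratio]
    field_simp
  rw [h, qnum, qnum]
  field_simp

lemma geometric_term_of_cpow_sub {q a b : ℂ} (hq : q ≠ 0) (ha : a ≠ 0) (hb : b ≠ 0) {m₁ m₂ : ℕ}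
    (hm : m₁ < m₂) (s : ℂ) (n : ℕ) :
    q ^ ((s - n - 3) * m₁ + (n + 1) * m₂) / (a ^ (s - n - 2) * b ^ ((n : ℂ) + 2)) =
      q ^ ((s - 3) * m₁ + (m₂ : ℂ)) / a ^ (s - 2) / b ^ 2 * (q ^ (m₂ - m₁) * a / b) ^ n := by
  have e₁ : (s - n - 3) * m₁ + (n + 1) * m₂ =
      ((s - 3) * m₁ + (m₂ : ℂ)) + (((m₂ - m₁) * n : ℕ) : ℂ) := by
    push_cast [Nat.cast_sub hm.le]
    ring
  have e₂ : s - n - 2 = s - 2 - n := by ring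
  have e₃ : (n : ℂ) + 2 = ((n + 2 : ℕ) : ℂ) := by push_cast; ring
  have h : a ^ (s - 2) ≠ 0 := by simp [cpow_eq_zero_iff, ha]
  rw [e₁, e₂, e₃, cpow_add _ _ hq, cpow_sub _ _ ha, cpow_natCast, cpow_natCast, cpow_natCast,
    pow_mul, div_pow, mul_pow, pow_add b]
  field_simp

lemma geometric_term_of_cpow_add {q a b : ℂ} (hq : q ≠ 0) (hb : b ≠ 0) {m₁ m₂ : ℕ}
    (hm : m₁ < m₂) (s : ℂ) (n : ℕ) :
    q ^ ((-(n : ℂ) - 1) * m₁ + (s + n - 1) * m₂) * a ^ n / b ^ (s + n) =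
      q ^ (-(m₁ : ℂ) + (s - 1) * m₂) / b ^ (s - 2) / b ^ 2 * (q ^ (m₂ - m₁) * a / b) ^ n := by
  have e₁ : (-(n : ℂ) - 1) * m₁ + (s + n - 1) * m₂ =
      (-(m₁ : ℂ) + (s - 1) * m₂) + (((m₂ - m₁) * n : ℕ) : ℂ) := by
    push_cast [Nat.cast_sub hm.le]
    ring
  have e₂ : s + n = s - 2 + ((n + 2 : ℕ) : ℂ) := by push_cast; ring
  have h : b ^ (s - 2) ≠ 0 := by simp [cpow_eq_zero_iff, hb]
  rw [e₁, e₂, cpow_add _ _ hq, cpow_add _ _ hb, cpow_natCast, cpow_natCast,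
    pow_mul, div_pow, mul_pow, pow_add b]
  field_simp

/-- For positive integers `m₁ < m₂` and `s ∈ ℂ`, the series
`Σ_{n=0}^∞ q^{(s−n−3)m₁+(n+1)m₂}/([m₁]_q^{s−n−2}[m₂]_q^{n+2})` and
`Σ_{n=0}^∞ q^{(−n−1)m₁+(s+n−1)m₂}[m₁]_q^{n}/[m₂]_q^{s+n}` converge absolutely and their
difference equals
`(1−q)²/((1−q^{m₂})² − (1−q^{m₁})(1−q^{m₂})q^{m₂−m₁}) ·
  (q^{(s−3)m₁+m₂}/[m₁]_q^{s−2} − q^{−m₁+(s−1)m₂}/[m₂]_q^{s−2})`. -/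
theorem geometric_inner_sum (q : ℝ) (hq0 : 0 < q) (hq1 : q < 1)
    (m₁ m₂ : ℕ) (hm₁ : 0 < m₁) (hm : m₁ < m₂) (s : ℂ) :
    Summable (fun n : ℕ =>
      (q : ℂ) ^ ((s - n - 3) * m₁ + (n + 1) * m₂) /
        ((qnum q m₁ : ℂ) ^ (s - n - 2) * (qnum q m₂ : ℂ) ^ ((n : ℂ) + 2))) ∧
    Summable (fun n : ℕ =>
      (q : ℂ) ^ ((-(n : ℂ) - 1) * m₁ + (s + n - 1) * m₂) * (qnum q m₁ : ℂ) ^ (n : ℕ) /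
        (qnum q m₂ : ℂ) ^ (s + n)) ∧
    (∑' n : ℕ,
      (q : ℂ) ^ ((s - n - 3) * m₁ + (n + 1) * m₂) /
        ((qnum q m₁ : ℂ) ^ (s - n - 2) * (qnum q m₂ : ℂ) ^ ((n : ℂ) + 2))) -
    (∑' n : ℕ,
      (q : ℂ) ^ ((-(n : ℂ) - 1) * m₁ + (s + n - 1) * m₂) * (qnum q m₁ : ℂ) ^ (n : ℕ) /
        (qnum q m₂ : ℂ) ^ (s + n)) =
      (((1 - q) ^ 2 : ℝ) : ℂ) /
          (((1 - q ^ m₂) ^ 2 - (1 - q ^ m₁) * (1 - q ^ m₂) * q ^ (m₂ - m₁) : ℝ) : ℂ) *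
        ((q : ℂ) ^ ((s - 3) * m₁ + (m₂ : ℂ)) / (qnum q m₁ : ℂ) ^ (s - 2) -
          (q : ℂ) ^ (-(m₁ : ℂ) + (s - 1) * m₂) / (qnum q m₂ : ℂ) ^ (s - 2)) := by
  have hq : (q : ℂ) ≠ 0 := ofReal_ne_zero.2 hq0.ne'
  have ha : (qnum q m₁ : ℂ) ≠ 0 := ofReal_ne_zero.2 (qnum_pos hq0 hq1 hm₁).ne'
  have hb : (qnum q m₂ : ℂ) ≠ 0 := ofReal_ne_zero.2 (qnum_pos hq0 hq1 (hm₁.trans hm)).ne'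
  have hr : (q : ℂ) ^ (m₂ - m₁) * qnum q m₁ / qnum q m₂ = (qratio q m₁ m₂ : ℂ) := by
    rw [qratio]
    push_cast
    rfl
  have hnorm : ‖(qratio q m₁ m₂ : ℂ)‖ < 1 := by
    rw [norm_real, Real.norm_of_nonneg (qratio_nonneg hq0 hq1 hm₁ hm)]
    exact qratio_lt_one hq0 hq1 hm₁ hm
  have hsum := summable_geometric_of_norm_lt_one hnorm
  have hden := congrArg ((↑) : ℝ → ℂ)
    (qnum_sq_mul_one_sub_qratio (m := m₁) hq0 hq1 (hm₁.trans hm))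
  rw [ofReal_div, ofReal_mul, ofReal_pow, ofReal_sub, ofReal_one] at hden
  simp only [geometric_term_of_cpow_sub hq ha hb hm, geometric_term_of_cpow_add hq hb hm, hr]
  refine ⟨hsum.mul_left _, hsum.mul_left _, ?_⟩
  rw [tsum_mul_left, tsum_mul_left, tsum_geometric_of_norm_lt_one hnorm,
    ← inv_div (_ : ℂ) (((1 - q) ^ 2 : ℝ) : ℂ), ← hden, mul_inv]
  ring
end

section
/- For every s ∈ ℂ with Re(s) > 2, the double series (1−q)² Σ_{0<m₁<m₂} q^{(s−3)m₁+m₂} / ( ((1−q^{m₂})² − (1−q^{m₁})(1−q^{m₂})q^{m₂−m₁}) · [m₁]_q^{s−2} ) converges absolutely and equals Σ_{m=1}^∞ (q^{(s−2)m}/[m]_q^{s−1}) · (Σ_{j=1}^{m} 1/[j]_q) − (1−q) Σ_{m=1}^∞ m·q^{(s−2)m}/[m]_q^{s−1}. -/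
open Complex

/-- The Lambert-type terms `q^(k+1)/(1-q^(k+1))`. -/
noncomputable def lambertTerm (q : ℝ) (k : ℕ) : ℝ := q ^ (k + 1) / (1 - q ^ (k + 1))

section

variable {q : ℝ}

lemma one_sub_le_one_sub_pow_succ (hq0 : 0 < q) (hq1 : q < 1) (k : ℕ) :
    1 - q ≤ 1 - q ^ (k + 1) := by
  have : q ^ (k + 1) ≤ q := pow_le_of_le_one hq0.le hq1.le k.succ_ne_zero
  linarith

lemma one_sub_pow_succ_pos (hq0 : 0 < q) (hq1 : q < 1) (k : ℕ) : 0 < 1 - q ^ (k + 1) :=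
  lt_of_lt_of_le (by linarith) (one_sub_le_one_sub_pow_succ hq0 hq1 k)

lemma one_le_qnum_succ (hq0 : 0 < q) (hq1 : q < 1) (k : ℕ) : 1 ≤ qnum q (k + 1) := by
  rw [qnum, one_le_div (by linarith)]
  exact one_sub_le_one_sub_pow_succ hq0 hq1 k

lemma summable_lambertTerm (hq0 : 0 < q) (hq1 : q < 1) : Summable (lambertTerm q) := by
  refine Summable.of_nonneg_of_le
    (fun k => div_nonneg (by positivity) (one_sub_pow_succ_pos hq0 hq1 k).le) (fun k => ?_)
    ((summable_geometric_of_lt_one hq0.le hq1).mul_left (q / (1 - q)))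
  rw [lambertTerm, div_mul_eq_mul_div, ← pow_succ']
  exact div_le_div_of_nonneg_left (by positivity) (by linarith)
    (one_sub_le_one_sub_pow_succ hq0 hq1 k)

lemma one_sub_mul_sum_lambertTerm (hq0 : 0 < q) (hq1 : q < 1) (M : ℕ) :
    (1 - q) * ∑ i ∈ Finset.range M, lambertTerm q i =
      ∑ j ∈ Finset.Icc 1 M, 1 / qnum q j - (1 - q) * M := by
  induction M with
  | zero => simp
  | succ M ih =>
    rw [Finset.sum_range_succ, mul_add, ih, Finset.sum_Icc_succ_top (by lia)]
    have h1 := (one_sub_pow_succ_pos hq0 hq1 M).ne'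
    have h2 : 1 - q ≠ 0 := by linarith
    have h3 : (1 - q) * lambertTerm q M = 1 / qnum q (M + 1) - (1 - q) := by
      rw [lambertTerm, qnum]
      field_simp
      ring
    rw [h3]
    push_cast
    ring

/-- The shifted differences of the Lambert series telescope. -/
lemma hasSum_lambertTerm_sub_shift (hq0 : 0 < q) (hq1 : q < 1) (M : ℕ) :
    HasSum (fun n => lambertTerm q n - lambertTerm q (n + M))
      (∑ i ∈ Finset.range M, lambertTerm q i) := by
  have h := (summable_lambertTerm hq0 hq1).hasSum
  simpa using h.sub ((hasSum_nat_add_iff' M).2 h)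

lemma double_series_denom_factor (a k : ℕ) :
    (1 - q ^ (a + k)) ^ 2 - (1 - q ^ a) * (1 - q ^ (a + k)) * q ^ (a + k - a) =
      (1 - q ^ (a + k)) * (1 - q ^ k) := by
  rw [Nat.add_sub_cancel_left, pow_add]
  ring

lemma lambertTerm_sub_shift (hq0 : 0 < q) (hq1 : q < 1) (m n : ℕ) :
    lambertTerm q n - lambertTerm q (n + (m + 1)) =
      q ^ (n + 1) * (1 - q ^ (m + 1)) /
        ((1 - q ^ (m + 1 + (n + 1))) * (1 - q ^ (n + 1))) := by
  have h1 := (one_sub_pow_succ_pos hq0 hq1 n).ne'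
  have h2 := (one_sub_pow_succ_pos hq0 hq1 (n + (m + 1))).ne'
  rw [show m + 1 + (n + 1) = n + (m + 1) + 1 by ring]
  rw [lambertTerm, lambertTerm, div_sub_div _ _ h1 h2, mul_comm (1 - q ^ (n + 1)) (1 - q ^ (n + (m + 1) + 1))]
  congr 1
  ring

lemma lambertTerm_sub_shift_bounds (hq0 : 0 < q) (hq1 : q < 1) (m n : ℕ) :
    0 ≤ lambertTerm q n - lambertTerm q (n + (m + 1)) ∧
      (1 - q) ^ 2 * (lambertTerm q n - lambertTerm q (n + (m + 1))) ≤ q ^ n := by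
  have h1 := one_sub_le_one_sub_pow_succ hq0 hq1 n
  have h2 := one_sub_le_one_sub_pow_succ hq0 hq1 (m + 1 + n)
  have h3 := one_sub_pow_succ_pos hq0 hq1 m
  have h4 : 0 < 1 - q := by linarith
  have h5 : (0 : ℝ) < q ^ (m + 1) := by positivity
  rw [add_assoc] at h2
  rw [lambertTerm_sub_shift hq0 hq1]
  have hD : (1 - q) ^ 2 ≤ (1 - q ^ (m + 1 + (n + 1))) * (1 - q ^ (n + 1)) := by
    rw [sq]
    exact mul_le_mul h2 h1 h4.le (h4.le.trans h2)
  have hD0 := lt_of_lt_of_le (pow_pos h4 2) hD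
  refine ⟨by positivity, ?_⟩
  rw [← mul_div_assoc, div_le_iff₀ hD0, mul_comm]
  refine mul_le_mul ?_ hD (by positivity) (by positivity)
  calc q ^ (n + 1) * (1 - q ^ (m + 1)) ≤ q ^ (n + 1) * 1 := by gcongr; linarith
    _ ≤ q ^ n := by rw [mul_one]; exact pow_le_pow_of_le_one hq0.le hq1.le (Nat.le_succ n)

lemma norm_cpow_div_qnum_le (hq0 : 0 < q) (hq1 : q < 1) {s : ℂ} (hs : 2 < s.re) (m : ℕ) :
    ‖(q : ℂ) ^ ((s - 2) * (m + 1 : ℕ)) / (qnum q (m + 1) : ℂ) ^ (s - 1)‖ ≤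
      (q ^ (s.re - 2)) ^ (m + 1) := by
  have h1 := one_le_qnum_succ hq0 hq1 m
  rw [norm_div, norm_cpow_eq_rpow_re_of_pos hq0, norm_cpow_eq_rpow_re_of_pos (by linarith)]
  have h2 : ((s - 2) * ((m + 1 : ℕ) : ℂ)).re = (s.re - 2) * ((m + 1 : ℕ) : ℝ) := by
    rw [← ofReal_natCast, re_mul_ofReal, sub_re, re_ofNat]
  rw [h2, Real.rpow_mul hq0.le, Real.rpow_natCast]
  refine div_le_self (by positivity) (Real.one_le_rpow h1 ?_)
  simp only [sub_re, one_re]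
  linarith

/-- Each term of the double series is a constant multiple of a telescoping difference. -/
lemma double_series_term_eq (hq0 : 0 < q) (hq1 : q < 1) (s : ℂ) (m n : ℕ) :
    (((1 - q) ^ 2 : ℝ) : ℂ) *
        (q : ℂ) ^ ((s - 3) * ((m + 1 : ℕ) : ℂ) + ((m + 1 + (n + 1) : ℕ) : ℂ)) /
      ((((1 - q ^ (m + 1 + (n + 1))) ^ 2 - (1 - q ^ (m + 1)) * (1 - q ^ (m + 1 + (n + 1))) *
          q ^ (m + 1 + (n + 1) - (m + 1)) : ℝ) : ℂ) * (qnum q (m + 1) : ℂ) ^ (s - 2)) =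
      (q : ℂ) ^ ((s - 2) * (m + 1 : ℕ)) / (qnum q (m + 1) : ℂ) ^ (s - 1) *
        (((1 - q) * (lambertTerm q n - lambertTerm q (n + (m + 1))) : ℝ) : ℂ) := by
  have hq : (q : ℂ) ≠ 0 := by exact_mod_cast hq0.ne'
  have hN : (qnum q (m + 1) : ℂ) ≠ 0 := by
    exact_mod_cast (lt_of_lt_of_le one_pos (one_le_qnum_succ hq0 hq1 m)).ne'
  have hNs : (qnum q (m + 1) : ℂ) ^ (s - 2) ≠ 0 := by simp [cpow_eq_zero_iff, hN]
  have e1 : (s - 3) * ((m + 1 : ℕ) : ℂ) + ((m + 1 + (n + 1) : ℕ) : ℂ) =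
      (s - 2) * ((m + 1 : ℕ) : ℂ) + ((n + 1 : ℕ) : ℂ) := by push_cast; ring
  have e2 : (qnum q (m + 1) : ℂ) ^ (s - 1) =
      (qnum q (m + 1) : ℂ) ^ (s - 2) * (qnum q (m + 1) : ℂ) := by
    rw [show s - 1 = s - 2 + 1 by ring,
      cpow_add _ _ hN, cpow_one]
  rw [e1, cpow_add _ _ hq, cpow_natCast, e2, double_series_denom_factor,
    lambertTerm_sub_shift hq0 hq1]
  have h1 : (1 - q : ℂ) ≠ 0 := by exact_mod_cast (by linarith : 1 - q ≠ 0)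
  have h2 : (1 - q ^ (m + 1) : ℂ) ≠ 0 := by exact_mod_cast (one_sub_pow_succ_pos hq0 hq1 m).ne'
  have h3 : (1 - q ^ (n + 1) : ℂ) ≠ 0 := by exact_mod_cast (one_sub_pow_succ_pos hq0 hq1 n).ne'
  have h4 : (1 - q ^ (m + 1 + (n + 1)) : ℂ) ≠ 0 := by
    exact_mod_cast (one_sub_pow_succ_pos hq0 hq1 (m + 1 + n)).ne'
  have e3 : (qnum q (m + 1) : ℂ) = (1 - q ^ (m + 1) : ℂ) / (1 - q : ℂ) := by
    rw [qnum]; push_cast; rfl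
  generalize (qnum q (m + 1) : ℂ) ^ (s - 2) = A at *
  generalize (q : ℂ) ^ ((s - 2) * (m + 1 : ℕ)) = B at *
  rw [e3]
  push_cast
  generalize (1 - q ^ (m + 1) : ℂ) = x at *
  generalize (1 - q ^ (n + 1) : ℂ) = y at *
  generalize (1 - q ^ (m + 1 + (n + 1)) : ℂ) = z at *
  field_simp

end

/-- Pairs `0 < m₁ < m₂` correspond to pairs of naturals `(m₁ - 1, m₂ - m₁ - 1)`. -/
def posLtPairEquiv : ℕ × ℕ ≃ {p : ℕ × ℕ // 0 < p.1 ∧ p.1 < p.2} where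
  toFun p := ⟨(p.1 + 1, p.1 + 1 + (p.2 + 1)), by lia, by lia⟩
  invFun p := (p.1.1 - 1, p.1.2 - p.1.1 - 1)
  left_inv p := by ext <;> simp
  right_inv p := by
    obtain ⟨⟨a, b⟩, h1, h2⟩ := p
    simp only [Subtype.mk.injEq, Prod.mk.injEq] at *
    lia

/-- For `Re(s) > 2`, the double series
`(1−q)² Σ_{0<m₁<m₂} q^{(s−3)m₁+m₂}/(((1−q^{m₂})² − (1−q^{m₁})(1−q^{m₂})q^{m₂−m₁})·[m₁]_q^{s−2})`
converges absolutely and equals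
`Σ_{m=1}^∞ (q^{(s−2)m}/[m]_q^{s−1})·(Σ_{j=1}^m 1/[j]_q) − (1−q) Σ_{m=1}^∞ m q^{(s−2)m}/[m]_q^{s−1}`. -/
theorem first_double_series_evaluation (q : ℝ) (hq0 : 0 < q) (hq1 : q < 1)
    (s : ℂ) (hs : 2 < s.re) :
    Summable (fun p : {p : ℕ × ℕ // 0 < p.1 ∧ p.1 < p.2} =>
      (((1 - q) ^ 2 : ℝ) : ℂ) * (q : ℂ) ^ ((s - 3) * p.1.1 + (p.1.2 : ℂ)) /
        ((((1 - q ^ p.1.2) ^ 2 - (1 - q ^ p.1.1) * (1 - q ^ p.1.2) * q ^ (p.1.2 - p.1.1) : ℝ) : ℂ) *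
          (qnum q p.1.1 : ℂ) ^ (s - 2))) ∧
    Summable (fun m : ℕ =>
      (q : ℂ) ^ ((s - 2) * (m + 1 : ℕ)) / (qnum q (m + 1) : ℂ) ^ (s - 1) *
        ((∑ j ∈ Finset.Icc 1 (m + 1), 1 / qnum q j : ℝ) : ℂ)) ∧
    Summable (fun m : ℕ =>
      ((m + 1 : ℕ) : ℂ) * (q : ℂ) ^ ((s - 2) * (m + 1 : ℕ)) / (qnum q (m + 1) : ℂ) ^ (s - 1)) ∧
    ∑' p : {p : ℕ × ℕ // 0 < p.1 ∧ p.1 < p.2},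
        (((1 - q) ^ 2 : ℝ) : ℂ) * (q : ℂ) ^ ((s - 3) * p.1.1 + (p.1.2 : ℂ)) /
          ((((1 - q ^ p.1.2) ^ 2 - (1 - q ^ p.1.1) * (1 - q ^ p.1.2) * q ^ (p.1.2 - p.1.1) : ℝ) : ℂ) *
            (qnum q p.1.1 : ℂ) ^ (s - 2)) =
      (∑' m : ℕ, (q : ℂ) ^ ((s - 2) * (m + 1 : ℕ)) / (qnum q (m + 1) : ℂ) ^ (s - 1) *
          ((∑ j ∈ Finset.Icc 1 (m + 1), 1 / qnum q j : ℝ) : ℂ)) -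
        (1 - (q : ℂ)) *
          ∑' m : ℕ, ((m + 1 : ℕ) : ℂ) * (q : ℂ) ^ ((s - 2) * (m + 1 : ℕ)) /
            (qnum q (m + 1) : ℂ) ^ (s - 1) := by
  set c : ℕ → ℂ := fun m =>
    (q : ℂ) ^ ((s - 2) * (m + 1 : ℕ)) / (qnum q (m + 1) : ℂ) ^ (s - 1) with hc
  set r : ℝ := q ^ (s.re - 2)
  have hr0 : 0 < r := Real.rpow_pos_of_pos hq0 _
  have hr1 : r < 1 := Real.rpow_lt_one hq0.le hq1 (by linarith)
  have hcr (m : ℕ) : ‖c m‖ ≤ r ^ (m + 1) := norm_cpow_div_qnum_le hq0 hq1 hs m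
  have hmajor : Summable fun m : ℕ => ((m + 1 : ℕ) : ℝ) * r ^ (m + 1) := by
    have h := summable_pow_mul_geometric_of_norm_lt_one (R := ℝ) 1 (r := r)
      (by rwa [Real.norm_of_nonneg hr0.le])
    simpa using (summable_nat_add_iff 1).2 h
  have hbound (f : ℕ → ℂ) (hf : ∀ m : ℕ, ‖f m‖ ≤ ((m + 1 : ℕ) : ℝ)) :
      Summable fun m => c m * f m := by
    refine Summable.of_norm_bounded hmajor fun m => ?_
    rw [norm_mul, mul_comm]
    exact mul_le_mul (hf m) (hcr m) (norm_nonneg _) (by positivity)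
  have hsumH : Summable fun m : ℕ =>
      c m * ((∑ j ∈ Finset.Icc 1 (m + 1), 1 / qnum q j : ℝ) : ℂ) := by
    refine hbound _ fun m => ?_
    have hle : ∀ j ∈ Finset.Icc 1 (m + 1), 0 ≤ 1 / qnum q j ∧ 1 / qnum q j ≤ 1 := by
      intro j hj
      obtain ⟨k, rfl⟩ := Nat.exists_eq_add_of_le' (Finset.mem_Icc.1 hj).1
      have h := one_le_qnum_succ hq0 hq1 k
      exact ⟨by positivity, by rw [div_le_one (by linarith)]; exact h⟩
    rw [norm_real, Real.norm_of_nonneg (Finset.sum_nonneg fun j hj => (hle j hj).1)]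
    simpa using Finset.sum_le_card_nsmul _ _ 1 fun j hj => (hle j hj).2
  have hsumM : Summable fun m : ℕ => c m * ((m + 1 : ℕ) : ℂ) :=
    hbound _ fun m => by rw [norm_natCast]
  have hcomm : (fun m : ℕ => ((m + 1 : ℕ) : ℂ) * (q : ℂ) ^ ((s - 2) * (m + 1 : ℕ)) /
      (qnum q (m + 1) : ℂ) ^ (s - 1)) = fun m => c m * ((m + 1 : ℕ) : ℂ) := by
    funext m
    rw [hc, mul_div_assoc, mul_comm]
  set F : {p : ℕ × ℕ // 0 < p.1 ∧ p.1 < p.2} → ℂ := fun p =>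
    (((1 - q) ^ 2 : ℝ) : ℂ) * (q : ℂ) ^ ((s - 3) * p.1.1 + (p.1.2 : ℂ)) /
      ((((1 - q ^ p.1.2) ^ 2 - (1 - q ^ p.1.1) * (1 - q ^ p.1.2) * q ^ (p.1.2 - p.1.1) : ℝ) : ℂ) *
        (qnum q p.1.1 : ℂ) ^ (s - 2))
  have hFe (m n : ℕ) : F (posLtPairEquiv (m, n)) =
      c m * (((1 - q) * (lambertTerm q n - lambertTerm q (n + (m + 1))) : ℝ) : ℂ) :=
    double_series_term_eq hq0 hq1 s m n
  have hFsum : Summable (F ∘ posLtPairEquiv) := by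
    have hmaj : Summable fun p : ℕ × ℕ => r ^ (p.1 + 1) * ((1 - q)⁻¹ * q ^ p.2) :=
      ((summable_nat_add_iff 1).2 (summable_geometric_of_lt_one hr0.le hr1)).mul_of_nonneg
        ((summable_geometric_of_lt_one hq0.le hq1).mul_left (1 - q)⁻¹)
        (fun _ => by positivity)
        (fun _ => mul_nonneg (inv_nonneg.2 (by linarith)) (by positivity))
    refine Summable.of_norm_bounded hmaj fun ⟨m, n⟩ => ?_
    obtain ⟨h0, h1⟩ := lambertTerm_sub_shift_bounds hq0 hq1 m n
    have hq' : 0 < 1 - q := by linarith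
    rw [Function.comp_apply, hFe, norm_mul, norm_real,
      Real.norm_of_nonneg (mul_nonneg hq'.le h0)]
    refine mul_le_mul (hcr m) ?_ (mul_nonneg hq'.le h0) (by positivity)
    rw [le_inv_mul_iff₀ hq', ← mul_assoc, ← sq]
    exact h1
  have hinner (m : ℕ) : HasSum (fun n => (F ∘ posLtPairEquiv) (m, n))
      (c m * ((∑ j ∈ Finset.Icc 1 (m + 1), 1 / qnum q j : ℝ) : ℂ) -
        (1 - (q : ℂ)) * (c m * ((m + 1 : ℕ) : ℂ))) := by
    have h := (hasSum_ofReal.2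
      ((hasSum_lambertTerm_sub_shift hq0 hq1 (m + 1)).mul_left (1 - q))).mul_left (c m)
    rw [one_sub_mul_sum_lambertTerm hq0 hq1] at h
    have hvalue :
        c m * ((∑ j ∈ Finset.Icc 1 (m + 1), 1 / qnum q j - (1 - q) * (m + 1 : ℕ) : ℝ) : ℂ) =
        c m * ((∑ j ∈ Finset.Icc 1 (m + 1), 1 / qnum q j : ℝ) : ℂ) -
          (1 - (q : ℂ)) * (c m * ((m + 1 : ℕ) : ℂ)) := by
      rw [ofReal_sub, ofReal_mul, ofReal_sub, ofReal_one, ofReal_natCast]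
      ring
    rw [hvalue] at h
    exact h.congr_fun fun n => hFe m n
  refine ⟨posLtPairEquiv.summable_iff.1 hFsum, hsumH, hcomm ▸ hsumM, ?_⟩
  rw [hcomm, ← posLtPairEquiv.tsum_eq F, ← tsum_mul_left,
    ← hsumH.tsum_sub (hsumM.mul_left _)]
  exact (hFsum.tsum_prod' fun m => (hinner m).summable).trans
    (tsum_congr fun m => (hinner m).tsum_eq)
end

section
/- Let d be a positive integer and D a non-negative integer. The series defining F_q^{(0)}(D;s;d) converges absolutely whenever Re(s) > 1, and the series defining F_q^{(1)}(D;s;d), F_q^{(2)}(D;s;d) and F_q^{(3)}(D;s;d) converge absolutely whenever Re(s) > d+2. -/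
open Complex

/-- The product `∏_i q^{n_i}/[n_i]_q` over a chain `n₁ ≤ ⋯ ≤ n_d`. -/
noncomputable def chainProd (q : ℝ) {d : ℕ} (n : Fin d → ℕ) : ℂ :=
  ∏ i, ((q : ℂ) ^ (n i) / (qnum q (n i) : ℂ))

/-- The index set for `F_q^{(0)}(D;s;d)`: pairs of `m > D` and chains
`m − D ≤ n₁ ≤ ⋯ ≤ n_d ≤ m`. -/
def F0Idx (D d : ℕ) : Type :=
  {p : ℕ × (Fin d → ℕ) // D < p.1 ∧ Monotone p.2 ∧ ∀ i, p.1 - D ≤ p.2 i ∧ p.2 i ≤ p.1}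

/-- The general term of the series `F_q^{(0)}(D;s;d)`. -/
noncomputable def F0term (q : ℝ) (d : ℕ) (s : ℂ) (p : ℕ × (Fin d → ℕ)) : ℂ :=
  ((q : ℂ) ^ ((s - (d : ℂ) - 1) * (p.1 : ℂ)) / (qnum q p.1 : ℂ) ^ (s - (d : ℂ))) *
    chainProd q p.2

/-- The index set for `F_q^{(1)}, F_q^{(2)}, F_q^{(3)}`: triples of `D < t < m` and chains
`m − t ≤ n₁ ≤ ⋯ ≤ n_d ≤ m`. -/
def FIdx (D d : ℕ) : Type :=
  {p : ℕ × ℕ × (Fin d → ℕ) // D < p.1 ∧ p.1 < p.2.1 ∧ Monotone p.2.2 ∧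
    ∀ i, p.2.1 - p.1 ≤ p.2.2 i ∧ p.2.2 i ≤ p.2.1}

/-- The general term of the series `F_q^{(1)}(D;s;d)`. -/
noncomputable def F1term (q : ℝ) (d : ℕ) (s : ℂ) (p : ℕ × ℕ × (Fin d → ℕ)) : ℂ :=
  ((q : ℂ) ^ ((s - (d : ℂ) - 2) * (p.1 : ℂ)) * (q : ℂ) ^ (p.2.1 - p.1) /
      ((qnum q p.1 : ℂ) ^ (s - (d : ℂ) - 1) * (qnum q (p.2.1 - p.1) : ℂ))) *
    chainProd q p.2.2

/-- The general term of the series `F_q^{(2)}(D;s;d)`. -/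
noncomputable def F2term (q : ℝ) (d : ℕ) (s : ℂ) (p : ℕ × ℕ × (Fin d → ℕ)) : ℂ :=
  ((q : ℂ) ^ ((s - (d : ℂ) - 2) * (p.2.1 : ℂ)) * (q : ℂ) ^ (p.2.1) /
      ((qnum q p.1 : ℂ) ^ (s - (d : ℂ) - 1) * (qnum q p.2.1 : ℂ))) *
    chainProd q p.2.2

/-- The general term of the series `F_q^{(3)}(D;s;d)`. -/
noncomputable def F3term (q : ℝ) (d : ℕ) (s : ℂ) (p : ℕ × ℕ × (Fin d → ℕ)) : ℂ :=
  ((q : ℂ) ^ ((s - (d : ℂ) - 2) * (p.2.1 : ℂ)) * (q : ℂ) ^ (p.2.1 - p.1) /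
      ((qnum q p.2.1 : ℂ) ^ (s - (d : ℂ) - 1) * (qnum q (p.2.1 - p.1) : ℂ))) *
    chainProd q p.2.2

theorem one_le_qnum {q : ℝ} (hq0 : 0 < q) (hq1 : q < 1) {n : ℕ} (hn : 1 ≤ n) :
    1 ≤ qnum q n := by
  rw [qnum, one_le_div (by linarith)]
  have := pow_le_of_le_one hq0.le hq1.le (n := n) (by omega)
  linarith

theorem qnum_le {q : ℝ} (hq0 : 0 < q) (hq1 : q < 1) (n : ℕ) :
    qnum q n ≤ 1 / (1 - q) := by
  have h : 0 < 1 - q := by linarith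
  rw [qnum]
  gcongr
  linarith [pow_pos hq0 n]

theorem norm_qnum {q : ℝ} (hq0 : 0 < q) (hq1 : q < 1) {n : ℕ} (hn : 1 ≤ n) :
    ‖(qnum q n : ℂ)‖ = qnum q n := by
  rw [norm_real, Real.norm_of_nonneg]
  linarith [one_le_qnum hq0 hq1 hn]

/-- The norm of `[n]_q ^ z` is at least `1` when `Re z ≥ 0`. -/
theorem one_le_norm_qnum_cpow {q : ℝ} (hq0 : 0 < q) (hq1 : q < 1) {n : ℕ} (hn : 1 ≤ n) {z : ℂ}
    (hz : 0 ≤ z.re) : 1 ≤ ‖(qnum q n : ℂ) ^ z‖ := by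
  have h := one_le_qnum hq0 hq1 hn
  rw [norm_cpow_eq_rpow_re_of_pos (by linarith)]
  exact Real.one_le_rpow h hz

/-- The norm of `[n]_q ^ z` is bounded below, uniformly in `n`. -/
theorem le_norm_qnum_cpow {q : ℝ} (hq0 : 0 < q) (hq1 : q < 1) {n : ℕ} (hn : 1 ≤ n) (z : ℂ) :
    (1 / (1 - q)) ^ (-|z.re|) ≤ ‖(qnum q n : ℂ) ^ z‖ := by
  have h := one_le_qnum hq0 hq1 hn
  rw [norm_cpow_eq_rpow_re_of_pos (by linarith)]
  calc (1 / (1 - q)) ^ (-|z.re|) ≤ qnum q n ^ (-|z.re|) :=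
        Real.rpow_le_rpow_of_nonpos (by linarith) (qnum_le hq0 hq1 n) (by simp)
    _ ≤ qnum q n ^ z.re := Real.rpow_le_rpow_of_exponent_le h (neg_abs_le _)

theorem norm_chainProd_le {q : ℝ} (hq0 : 0 < q) (hq1 : q < 1) {d : ℕ} {n : Fin d → ℕ} {k : ℕ}
    (hk : 1 ≤ k) (hn : ∀ i, k ≤ n i) : ‖chainProd q n‖ ≤ q ^ (k * d) := by
  rw [chainProd, norm_prod]
  calc ∏ i, ‖(q : ℂ) ^ n i / (qnum q (n i) : ℂ)‖ ≤ ∏ _i : Fin d, q ^ k := by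
        refine Finset.prod_le_prod (fun _ _ => norm_nonneg _) fun i _ => ?_
        have h1 : 1 ≤ n i := hk.trans (hn i)
        rw [norm_div, norm_qnum hq0 hq1 h1, norm_pow, norm_real, Real.norm_of_nonneg hq0.le]
        exact (div_le_self (by positivity) (one_le_qnum hq0 hq1 h1)).trans
          (pow_le_pow_of_le_one hq0.le hq1.le (hn i))
    _ = q ^ (k * d) := by simp [pow_mul]

theorem norm_chainProd_le_one {q : ℝ} (hq0 : 0 < q) (hq1 : q < 1) {d : ℕ} {n : Fin d → ℕ}
    (hn : ∀ i, 1 ≤ n i) : ‖chainProd q n‖ ≤ 1 :=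
  (norm_chainProd_le hq0 hq1 le_rfl hn).trans (pow_le_one₀ hq0.le hq1.le)

theorem summable_prod_geometric {r : ℝ} (h0 : 0 ≤ r) (h1 : r < 1) (d : ℕ) :
    Summable fun n : Fin d → ℕ => ∏ i, r ^ n i := by
  induction d with
  | zero => exact Summable.of_finite
  | succ d ih =>
    rw [← (Fin.consEquiv fun _ : Fin (d + 1) => ℕ).summable_iff]
    have := (summable_geometric_of_lt_one h0 h1).mul_of_nonneg ih
      (fun _ => by positivity) (fun _ => Finset.prod_nonneg fun _ _ => by positivity)
    refine this.congr fun p => ?_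
    simp [Fin.consEquiv, Fin.prod_univ_succ]

theorem rpow_div_pow {q : ℝ} (hq0 : 0 < q) (b x : ℝ) (k : ℕ) (hk : k ≠ 0) :
    q ^ (b * x) = (q ^ (b / k * x)) ^ k := by
  rw [← Real.rpow_mul_natCast hq0.le]
  congr 1
  field_simp

theorem rpow_mul_le_pow {q : ℝ} (hq0 : 0 < q) (hq1 : q < 1) {c : ℝ} (hc : 0 < c) {n m : ℕ}
    (h : n ≤ m) : q ^ (c * m) ≤ (q ^ c) ^ n := by
  rw [← Real.rpow_mul_natCast hq0.le]
  apply Real.rpow_le_rpow_of_exponent_ge hq0 hq1.le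
  gcongr

/-- A family over chains `n₁ ≤ ⋯ ≤ n_d ≤ m` which decays geometrically in `m` is summable. -/
theorem summable_F0Idx {q : ℝ} (hq0 : 0 < q) (hq1 : q < 1) {d D : ℕ} {f : F0Idx D d → ℂ}
    {b C : ℝ} (hb : 0 < b) (hC : 0 ≤ C) (hf : ∀ p, ‖f p‖ ≤ C * q ^ (b * (p.1.1 : ℝ))) :
    Summable f := by
  set c := b / (d + 1 : ℕ) with hc
  have hc0 : 0 < c := by positivity
  have hr0 : 0 ≤ q ^ c := by positivity
  have hr1 : q ^ c < 1 := Real.rpow_lt_one hq0.le hq1 hc0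
  have hs := ((summable_geometric_of_lt_one hr0 hr1).mul_of_nonneg
    (summable_prod_geometric hr0 hr1 d) (fun _ => by positivity)
    (fun _ => Finset.prod_nonneg fun _ _ => by positivity)).mul_left C
  refine .of_norm_bounded (hs.comp_injective (i := fun p : F0Idx D d => p.1)
    Subtype.val_injective) fun p => (hf p).trans ?_
  obtain ⟨⟨m, n⟩, -, -, hn⟩ := p
  dsimp only [Function.comp_apply] at hn ⊢
  refine mul_le_mul_of_nonneg_left ?_ hC
  rw [rpow_div_pow hq0 b m (d + 1) (by omega), ← hc, pow_succ']
  refine mul_le_mul (rpow_mul_le_pow hq0 hq1 hc0 le_rfl) ?_ (by positivity) (by positivity)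
  rw [← Fin.prod_const]
  exact Finset.prod_le_prod (fun _ _ => by positivity)
    fun i _ => rpow_mul_le_pow hq0 hq1 hc0 (hn i).2

/-- A family over `t < m` and chains `n₁ ≤ ⋯ ≤ n_d ≤ m` which decays geometrically in `m` is
summable. -/
theorem summable_FIdx {q : ℝ} (hq0 : 0 < q) (hq1 : q < 1) {d D : ℕ} {f : FIdx D d → ℂ}
    {b : ℝ} (hb : 0 < b) (hf : ∀ p, ‖f p‖ ≤ q ^ (b * (p.1.2.1 : ℝ))) :
    Summable f := by
  set c := b / (d + 1 + 1 : ℕ) with hc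
  have hc0 : 0 < c := by positivity
  have hr0 : 0 ≤ q ^ c := by positivity
  have hr1 : q ^ c < 1 := Real.rpow_lt_one hq0.le hq1 hc0
  have hg := summable_geometric_of_lt_one hr0 hr1
  have hs := hg.mul_of_nonneg (hg.mul_of_nonneg
    (summable_prod_geometric hr0 hr1 d) (fun _ => by positivity)
    (fun _ => Finset.prod_nonneg fun _ _ => by positivity)) (fun _ => by positivity)
    (fun _ => mul_nonneg (by positivity) (Finset.prod_nonneg fun _ _ => by positivity))
  refine .of_norm_bounded (hs.comp_injective (i := fun p : FIdx D d => p.1)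
    Subtype.val_injective) fun p => (hf p).trans ?_
  obtain ⟨⟨t, m, n⟩, -, ht, -, hn⟩ := p
  dsimp only [Function.comp_apply] at ht hn ⊢
  rw [rpow_div_pow hq0 b m (d + 1 + 1) (by omega), ← hc, pow_succ', pow_succ']
  refine mul_le_mul (rpow_mul_le_pow hq0 hq1 hc0 ht.le) ?_ (by positivity) (by positivity)
  refine mul_le_mul (rpow_mul_le_pow hq0 hq1 hc0 le_rfl) ?_ (by positivity) (by positivity)
  rw [← Fin.prod_const]
  exact Finset.prod_le_prod (fun _ _ => by positivity)
    fun i _ => rpow_mul_le_pow hq0 hq1 hc0 (hn i).2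

theorem norm_cpow_mul_natCast {q : ℝ} (hq0 : 0 < q) (z : ℂ) (n : ℕ) :
    ‖(q : ℂ) ^ (z * (n : ℂ))‖ = q ^ (z.re * (n : ℝ)) := by
  rw [norm_cpow_eq_rpow_re_of_pos hq0]
  simp

theorem summable_F0term {q : ℝ} (hq0 : 0 < q) (hq1 : q < 1) (d D : ℕ) {s : ℂ} (hs : 1 < s.re) :
    Summable fun p : F0Idx D d => F0term q d s p.1 := by
  have hq : 0 < 1 / (1 - q) := one_div_pos.2 (by linarith)
  set K := (1 / (1 - q)) ^ (-|(s - (d : ℂ)).re|)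
  have hK : 0 < K := by positivity
  refine summable_F0Idx hq0 hq1 (b := s.re - 1) (C := 1 / K * q ^ (-(D * d : ℝ)))
    (by linarith) (by positivity) ?_
  rintro ⟨⟨m, n⟩, hm, -, hn⟩
  dsimp only at hm hn ⊢
  rw [F0term, norm_mul, norm_div, norm_cpow_mul_natCast hq0]
  have h1 := norm_chainProd_le hq0 hq1 (k := m - D) (by omega) fun i => (hn i).1
  have h2 : K ≤ ‖(qnum q m : ℂ) ^ (s - (d : ℂ))‖ := le_norm_qnum_cpow hq0 hq1 (by omega) _
  calc _ ≤ q ^ ((s - (d : ℂ) - 1).re * m) / K * q ^ ((m - D) * d) := by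
        gcongr
    _ = _ := by
        rw [← Real.rpow_natCast q ((m - D) * d), div_mul_eq_mul_div, ← Real.rpow_add hq0,
          mul_assoc, ← Real.rpow_add hq0, one_div_mul_eq_div]
        congr 2
        push_cast [Nat.cast_sub hm.le]
        simp
        ring

/-- The common shape of the terms of `F_q^{(1)}, F_q^{(2)}, F_q^{(3)}`: denominators of norm at
least `1` may be dropped. -/
theorem norm_term_le {q : ℝ} (hq0 : 0 < q) {u v w : ℂ} (z : ℂ) (k l : ℕ)
    (hu : 1 ≤ ‖u‖) (hv : 1 ≤ ‖v‖) (hw : ‖w‖ ≤ 1) {b x : ℝ}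
    (h : q ^ (z.re * k + l) ≤ q ^ (b * x)) :
    ‖(q : ℂ) ^ (z * (k : ℂ)) * (q : ℂ) ^ l / (u * v) * w‖ ≤ q ^ (b * x) := by
  rw [norm_mul, norm_div, norm_mul, norm_mul, norm_cpow_mul_natCast hq0, norm_pow, norm_real,
    Real.norm_of_nonneg hq0.le, ← Real.rpow_natCast q l, ← Real.rpow_add hq0]
  refine (mul_le_of_le_one_right (by positivity) hw).trans (le_trans ?_ h)
  exact div_le_self (by positivity) (one_le_mul_of_one_le_of_one_le hu hv)

/-- The series defining `F_q^{(0)}(D;s;d)` converges absolutely whenever `Re(s) > 1`, and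
those defining `F_q^{(1)}(D;s;d)`, `F_q^{(2)}(D;s;d)`, `F_q^{(3)}(D;s;d)` converge
absolutely whenever `Re(s) > d + 2`. -/
theorem F_summable (q : ℝ) (hq0 : 0 < q) (hq1 : q < 1) (d D : ℕ) (hd : 1 ≤ d) (s : ℂ) :
    (1 < s.re → Summable (fun p : F0Idx D d => F0term q d s p.1)) ∧
    ((d : ℝ) + 2 < s.re →
      Summable (fun p : FIdx D d => F1term q d s p.1) ∧
      Summable (fun p : FIdx D d => F2term q d s p.1) ∧
      Summable (fun p : FIdx D d => F3term q d s p.1)) := by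
  refine ⟨summable_F0term hq0 hq1 d D, fun hs => ?_⟩
  have ha : (s - (d : ℂ) - 2).re = s.re - d - 2 := by simp
  have hz : 0 ≤ (s - (d : ℂ) - 1).re := by simp; linarith
  have hv {n : ℕ} (hn : 1 ≤ n) : 1 ≤ ‖(qnum q n : ℂ)‖ :=
    (one_le_qnum hq0 hq1 hn).trans_eq (norm_qnum hq0 hq1 hn).symm
  have hb : 0 < min (s.re - d - 2) 1 := lt_min (by linarith) one_pos
  have hb1 := min_le_left (s.re - d - 2) 1
  have hb2 := min_le_right (s.re - d - 2) 1
  refine ⟨?_, ?_, ?_⟩ <;>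
  · refine summable_FIdx hq0 hq1 hb ?_
    rintro ⟨⟨t, m, n⟩, ht, hm, -, hn⟩
    dsimp only at ht hm hn ⊢
    refine norm_term_le hq0 _ _ _ (one_le_norm_qnum_cpow hq0 hq1 ?_ hz) (hv ?_)
      (norm_chainProd_le_one hq0 hq1 fun i => le_trans (by omega) (hn i).1)
      (Real.rpow_le_rpow_of_exponent_ge hq0 hq1.le ?_) <;> dsimp only
    · omega
    · omega
    rw [ha]
    have ht0 : (0 : ℝ) ≤ t := t.cast_nonneg
    have hm' : (t : ℝ) ≤ m := by exact_mod_cast hm.le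
    push_cast [Nat.cast_sub hm.le]
    nlinarith
end
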